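/- arXiv:2603.29731 — 3 statements merged into one kernel-verified Lean document; each statement's English description precedes it below -/
import Mathlib

section
/- Let B : ℝ × ℝ → M₂(ℂ) be continuous, smooth in (y,λ) for λ≠0, with ‖∂_λ^α B(y,λ)‖ ≲ |λ|^{-α}⟨y⟩^{-2} for all α ∈ ℕ₀ and ‖∂_y B(y,λ)‖ ≲ ⟨y⟩^{-2}. Then for each λ there exists a solution w₊(·,λ) of the ODE ∂_y w₊ = B(y,λ) w₊ on ℝ such that w₊ is bounded uniformly in (y,λ), the limit w₊(+∞,λ) := lim_{y→∞} w₊(y,λ) exists and equals (1, i), and the convergence w₊(y,λ)→w₊(+∞,λ) as y→∞ is uniform in λ. -/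
open Set Filter

open MeasureTheory in
/-- The tail integral `y ↦ ∫_y^∞ F` of a continuous integrable function has derivative `-F`. -/
theorem hasDerivAt_integral_Ioi_of_continuous {E : Type*} [NormedAddCommGroup E] [NormedSpace ℝ E]
    [CompleteSpace E] {F : ℝ → E} (hF : Continuous F) (hFi : Integrable F) (y : ℝ) :
    HasDerivAt (fun t => ∫ s in Ioi t, F s) (-F y) y := by
  have h : (fun t => ∫ s in Ioi t, F s) = fun t => (∫ s in Ioi 0, F s) - ∫ s in (0 : ℝ)..t, F s := by
    funext t
    rw [← intervalIntegral.integral_Ioi_sub_Ioi' hFi.integrableOn hFi.integrableOn]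
    abel
  rw [h]
  exact (intervalIntegral.integral_hasDerivAt_right (hF.intervalIntegrable _ _)
    (hF.stronglyMeasurableAtFilter _ _) hF.continuousAt).const_sub _

open MeasureTheory in
theorem integrable_exp_arctan_weight {C : ℝ} (hC : 0 ≤ C) :
    Integrable fun s : ℝ => Real.exp (-(2 * C) * Real.arctan s) * (C * (1 + s ^ 2)⁻¹) := by
  have hpos : ∀ s : ℝ, (1 + s ^ 2) ≠ 0 := fun s => by positivity
  refine ((integrable_inv_one_add_sq.const_mul C).const_mul (Real.exp (C * Real.pi))).mono'
    (Continuous.aestronglyMeasurable (by fun_prop (disch := assumption))) (.of_forall fun s => ?_)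
  rw [Real.norm_of_nonneg (by positivity)]
  gcongr ?_ * _
  exact Real.exp_le_exp.2 (by nlinarith [Real.neg_pi_div_two_lt_arctan s])

open MeasureTheory in
theorem integral_Ioi_exp_arctan_weight_le {C : ℝ} (hC : 0 ≤ C) (y : ℝ) :
    ∫ s in Ioi y, Real.exp (-(2 * C) * Real.arctan s) * (C * (1 + s ^ 2)⁻¹) ≤
      Real.exp (-(2 * C) * Real.arctan y) / 2 := by
  have hd : ∀ x ∈ Ici y, HasDerivAt (fun s => -(Real.exp (-(2 * C) * Real.arctan s) / 2))
      (Real.exp (-(2 * C) * Real.arctan x) * (C * (1 + x ^ 2)⁻¹)) x := fun x _ => 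
    ((((Real.hasDerivAt_arctan' x).const_mul (-(2 * C))).exp.div_const 2).neg).congr_deriv (by ring)
  have ht : Tendsto (fun s => -(Real.exp (-(2 * C) * Real.arctan s) / 2)) atTop
      (nhds (-(Real.exp (-(2 * C) * (Real.pi / 2)) / 2))) :=
    (((tendsto_nhds_of_tendsto_nhdsWithin Real.tendsto_arctan_atTop).const_mul _).rexp.div_const
      2).neg
  rw [integral_Ioi_of_hasDerivAt_of_tendsto' hd (integrable_exp_arctan_weight hC).integrableOn ht]
  linarith [Real.exp_pos (-(2 * C) * (Real.pi / 2))]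

open MeasureTheory BoundedContinuousFunction in
/-- A linear ODE `w' = A w` on the line with `‖A y‖ ≤ C / (1 + y²)` has a solution with any
prescribed limit `v` at `+∞`, with bounds depending only on `C` and `‖v‖`. -/
theorem exists_hasDerivAt_of_norm_le_inv_one_add_sq {𝕜 E : Type*} [NontriviallyNormedField 𝕜]
    [NormedAddCommGroup E] [NormedSpace ℝ E] [NormedSpace 𝕜 E] [CompleteSpace E]
    {A : ℝ → E →L[𝕜] E} (hA : Continuous A) {C : ℝ} (hC : 0 ≤ C)
    (hAC : ∀ y, ‖A y‖ ≤ C * (1 + y ^ 2)⁻¹) (v : E) :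
    ∃ w : ℝ → E, (∀ y, HasDerivAt w (A y (w y)) y) ∧
      (∀ y, ‖w y‖ ≤ Real.exp (C * Real.pi) * (2 * (Real.exp (C * Real.pi) * ‖v‖))) ∧
      ∀ y, ‖w y - v‖ ≤ C * (Real.exp (C * Real.pi) * (2 * (Real.exp (C * Real.pi) * ‖v‖))) *
        (Real.pi / 2 - Real.arctan y) := by
  have g_le : ∀ s, Real.exp (-(2 * C) * Real.arctan s) ≤ Real.exp (C * Real.pi) := fun s =>
    Real.exp_le_exp.2 (by nlinarith [Real.neg_pi_div_two_lt_arctan s])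
  have g_inv_le : ∀ s, Real.exp (2 * C * Real.arctan s) ≤ Real.exp (C * Real.pi) := fun s =>
    Real.exp_le_exp.2 (by nlinarith [Real.arctan_lt_pi_div_two s])
  have g_mul : ∀ s, Real.exp (2 * C * Real.arctan s) * Real.exp (-(2 * C) * Real.arctan s) = 1 :=
    fun s => by rw [← Real.exp_add]; simp
  -- The unknown is rescaled by an exponential weight, which makes the integral operator contract.
  let F : (ℝ →ᵇ E) → ℝ → E := fun u s => A s (Real.exp (-(2 * C) * Real.arctan s) • u s)
  have F_cont : ∀ u, Continuous (F u) := fun u =>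
    hA.clm_apply (by have := u.continuous; fun_prop)
  have F_le : ∀ u s, ‖F u s‖ ≤
      Real.exp (-(2 * C) * Real.arctan s) * (C * (1 + s ^ 2)⁻¹) * ‖u‖ := fun u s => by
    calc ‖F u s‖ ≤ ‖A s‖ * ‖Real.exp (-(2 * C) * Real.arctan s) • u s‖ := (A s).le_opNorm _
      _ ≤ (C * (1 + s ^ 2)⁻¹) * (Real.exp (-(2 * C) * Real.arctan s) * ‖u‖) := by
        rw [norm_smul, Real.norm_of_nonneg (Real.exp_nonneg _)]
        gcongr
        · exact hAC s
        · exact u.norm_coe_le_norm s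
      _ = _ := by ring
  have F_int : ∀ u, Integrable (F u) := fun u =>
    ((integrable_exp_arctan_weight hC).mul_const ‖u‖).mono' (F_cont u).aestronglyMeasurable
      (.of_forall (F_le u))
  have F_sub : ∀ u u' s, F (u - u') s = F u s - F u' s := fun u u' s => by
    simp [F, smul_sub]
  have tail_le : ∀ u y, ‖Real.exp (2 * C * Real.arctan y) • ∫ s in Ioi y, F u s‖ ≤
      1 / 2 * ‖u‖ := fun u y => by
    rw [norm_smul, Real.norm_of_nonneg (Real.exp_nonneg _)]
    have h := norm_integral_le_of_norm_le
      ((integrable_exp_arctan_weight hC).mul_const ‖u‖).integrableOn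
      (.of_forall (F_le u) : ∀ᵐ s ∂volume.restrict (Ioi y), _)
    rw [integral_mul_const] at h
    calc _ ≤ Real.exp (2 * C * Real.arctan y) *
          (Real.exp (-(2 * C) * Real.arctan y) / 2 * ‖u‖) := by
          gcongr
          exact h.trans (by gcongr; exact integral_Ioi_exp_arctan_weight_le hC y)
      _ = (Real.exp (2 * C * Real.arctan y) * Real.exp (-(2 * C) * Real.arctan y)) *
          (1 / 2 * ‖u‖) := by ring
      _ = _ := by rw [g_mul, one_mul]
  have tail_deriv : ∀ u y, HasDerivAt (fun t => v - ∫ s in Ioi t, F u s) (F u y) y := fun u y => by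
    simpa using (hasDerivAt_integral_Ioi_of_continuous (F_cont u) (F_int u) y).const_sub v
  have S_le : ∀ u y, ‖Real.exp (2 * C * Real.arctan y) • (v - ∫ s in Ioi y, F u s)‖ ≤
      Real.exp (C * Real.pi) * ‖v‖ + 1 / 2 * ‖u‖ := fun u y => by
    rw [smul_sub]
    refine (norm_sub_le _ _).trans (add_le_add ?_ (tail_le u y))
    rw [norm_smul, Real.norm_of_nonneg (Real.exp_nonneg _)]
    exact mul_le_mul_of_nonneg_right (g_inv_le y) (norm_nonneg v)
  let S : (ℝ →ᵇ E) → (ℝ →ᵇ E) := fun u => ofNormedAddCommGroup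
    (fun y => Real.exp (2 * C * Real.arctan y) • (v - ∫ s in Ioi y, F u s))
    (have : Continuous fun y => v - ∫ s in Ioi y, F u s :=
      continuous_iff_continuousAt.2 fun y => (tail_deriv u y).continuousAt
     by fun_prop) _ (S_le u)
  have S_contr : ContractingWith (1 / 2) S := by
    refine ⟨by rw [← NNReal.coe_lt_coe]; norm_num, LipschitzWith.of_dist_le_mul fun u u' => ?_⟩
    rw [dist_eq_norm, dist_eq_norm]
    refine (norm_le (by positivity)).2 fun y => ?_
    have h : (S u - S u') y = -(Real.exp (2 * C * Real.arctan y) • ∫ s in Ioi y, F (u - u') s) := by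
      simp only [F_sub]
      rw [integral_sub (F_int u).integrableOn (F_int u').integrableOn]
      simp only [S, coe_sub, Pi.sub_apply, coe_ofNormedAddCommGroup, ← smul_sub, ← smul_neg]
      congr 1
      abel
    rw [h, norm_neg]
    simpa using tail_le (u - u') y
  obtain ⟨u, hu, -⟩ := S_contr.exists_fixedPoint 0 (edist_ne_top _ _)
  have u_apply : ∀ y, u y = Real.exp (2 * C * Real.arctan y) • (v - ∫ s in Ioi y, F u s) :=
    fun y => (DFunLike.congr_fun hu y).symm
  have u_norm : ‖u‖ ≤ 2 * (Real.exp (C * Real.pi) * ‖v‖) := by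
    have := (norm_le (f := u) (by positivity)).2 fun y => (u_apply y) ▸ S_le u y
    linarith
  have w_eq : ∀ y, Real.exp (-(2 * C) * Real.arctan y) • u y = v - ∫ s in Ioi y, F u s :=
    fun y => by rw [u_apply y, smul_smul, mul_comm, g_mul, one_smul]
  have w_le : ∀ y, ‖Real.exp (-(2 * C) * Real.arctan y) • u y‖ ≤
      Real.exp (C * Real.pi) * (2 * (Real.exp (C * Real.pi) * ‖v‖)) := fun y => by
    rw [norm_smul, Real.norm_of_nonneg (Real.exp_nonneg _)]
    exact mul_le_mul (g_le y) ((u.norm_coe_le_norm y).trans u_norm) (norm_nonneg _)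
      (Real.exp_nonneg _)
  refine ⟨fun y => Real.exp (-(2 * C) * Real.arctan y) • u y, fun y => ?_, w_le, fun y => ?_⟩
  · exact (tail_deriv u y).congr_of_eventuallyEq (.of_forall w_eq)
  · beta_reduce
    rw [w_eq, sub_sub_cancel_left, norm_neg, ← integral_Ioi_inv_one_add_sq, ← integral_const_mul]
    refine norm_integral_le_of_norm_le (integrable_inv_one_add_sq.const_mul _).integrableOn
      (.of_forall fun s => ?_)
    calc ‖F u s‖ ≤ ‖A s‖ * ‖Real.exp (-(2 * C) * Real.arctan s) • u s‖ := (A s).le_opNorm _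
      _ ≤ (C * (1 + s ^ 2)⁻¹) *
          (Real.exp (C * Real.pi) * (2 * (Real.exp (C * Real.pi) * ‖v‖))) := by
        gcongr
        · exact hAC s
        · exact w_le s
      _ = _ := by ring

/-- Existence of a bounded non-oscillating solution `w₊` of `∂_y w = B(y,λ) w` with
`w₊(y,λ) → (1, i)` as `y → ∞`, uniformly in `λ`. -/
theorem ode_nonoscillating_solution
    (B : ℝ → ℝ → (EuclideanSpace ℂ (Fin 2) →L[ℂ] EuclideanSpace ℂ (Fin 2)))
    (hB_cont : Continuous (fun p : ℝ × ℝ => B p.1 p.2))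
    (hB_smooth : ContDiffOn ℝ (⊤ : ℕ∞) (fun p : ℝ × ℝ => B p.1 p.2) {p : ℝ × ℝ | p.2 ≠ 0})
    (hB_lam : ∀ α : ℕ, ∃ C > (0:ℝ), ∀ (y l : ℝ), l ≠ 0 →
      ‖iteratedDeriv α (fun s => B y s) l‖ ≤ C * |l| ^ (-(α:ℝ)) * (1 + y^2)⁻¹)
    (hB_y : ∃ C > (0:ℝ), ∀ (y l : ℝ), ‖deriv (fun s => B s l) y‖ ≤ C * (1 + y^2)⁻¹) :
    ∃ w : ℝ → ℝ → EuclideanSpace ℂ (Fin 2),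
      (∀ (l y : ℝ), HasDerivAt (fun s => w s l) (B y l (w y l)) y) ∧
      (∃ C : ℝ, ∀ (y l : ℝ), ‖w y l‖ ≤ C) ∧
      (∀ l : ℝ, Tendsto (fun y => w y l) atTop
        (nhds ((WithLp.equiv 2 (Fin 2 → ℂ)).symm ![1, Complex.I]))) ∧
      TendstoUniformly (fun y l => w y l)
        (fun _ => (WithLp.equiv 2 (Fin 2 → ℂ)).symm ![1, Complex.I]) atTop := by
  obtain ⟨C, hC, hBC⟩ := hB_lam 0
  have hB : ∀ l y, ‖B y l‖ ≤ C * (1 + y ^ 2)⁻¹ := fun l y => by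
    have hclosed : IsClosed {l : ℝ | ‖B y l‖ ≤ C * (1 + y ^ 2)⁻¹} :=
      isClosed_le (hB_cont.comp (by fun_prop : Continuous fun l : ℝ => (y, l))).norm
        continuous_const
    have hsub : ({0}ᶜ : Set ℝ) ⊆ {l : ℝ | ‖B y l‖ ≤ C * (1 + y ^ 2)⁻¹} := fun l hl => by
      simpa using hBC y l hl
    exact hclosed.closure_subset_iff.2 hsub ((dense_compl_singleton (0 : ℝ)) l)
  choose w hw hw_le hw_sub using fun l => exists_hasDerivAt_of_norm_le_inv_one_add_sq
    (hB_cont.comp (by fun_prop : Continuous fun y : ℝ => (y, l))) hC.le (hB l)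
    ((WithLp.equiv 2 (Fin 2 → ℂ)).symm ![1, Complex.I])
  have hunif : TendstoUniformly (fun y l => w l y)
      (fun _ => (WithLp.equiv 2 (Fin 2 → ℂ)).symm ![1, Complex.I]) atTop := by
    rw [Metric.tendstoUniformly_iff]
    intro ε hε
    have ht := ((tendsto_nhds_of_tendsto_nhdsWithin Real.tendsto_arctan_atTop).const_sub
      (Real.pi / 2)).const_mul (C * (Real.exp (C * Real.pi) * (2 * (Real.exp (C * Real.pi) *
        ‖(WithLp.equiv 2 (Fin 2 → ℂ)).symm ![1, Complex.I]‖))))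
    rw [sub_self, mul_zero] at ht
    filter_upwards [ht.eventually_lt_const hε] with y hy l
    rw [dist_comm, dist_eq_norm]
    exact (hw_sub l y).trans_lt hy
  exact ⟨fun y l => w l y, hw, ⟨_, fun y l => hw_le l y⟩, fun l => hunif.tendsto_at l, hunif⟩
end

section
/- Let W : ℝ × ℝ → ℝ be continuous, smooth for λ≠0, with |∂_λ^α W(y,λ)| ≲ |λ|^{-α}⟨y⟩^{-2} for all α ∈ ℕ₀ and |∂_y W(y,λ)| ≲ ⟨y⟩^{-3}. Then there exist solutions v₊(·,λ) of −v'' + W(y,λ)v = v on ℝ of the form v₊(y,λ) = a₊₊(y,λ)e^{iy} + a₊₋(y,λ)e^{-iy} where a₊₊(y,λ) → 1 and a₊₋(y,λ) → 0 as y → +∞, uniformly in λ, and |a₊₋(y,λ)| ≲ ⟨y⟩^{-2} uniformly for y ≥ 0 and λ ∈ ℝ. -/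
open Set Filter

section TailIntegrals

open MeasureTheory

theorem hasDerivAt_integral_Ioi {f : ℝ → ℂ} (hf : Continuous f) (hi : Integrable f) (y : ℝ) :
    HasDerivAt (fun x => ∫ s in Ioi x, f s) (-f y) y := by
  have h : (fun x => ∫ s in Ioi x, f s) =
      fun x => (∫ s in Ioi (0 : ℝ), f s) - ∫ s in (0 : ℝ)..x, f s := by
    funext x
    rw [← intervalIntegral.integral_interval_add_Ioi' (hf.intervalIntegrable 0 x)
      hi.integrableOn, add_sub_cancel_left]
  rw [h]
  exact (intervalIntegral.integral_hasDerivAt_right (hf.intervalIntegrable 0 y)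
    hf.stronglyMeasurable.stronglyMeasurableAtFilter hf.continuousAt).const_sub _

theorem setIntegral_Ioi_comp_add_right (f : ℝ → ℂ) (a h : ℝ) :
    ∫ s in Ioi a, f (s + h) = ∫ s in Ioi (a + h), f s := by
  have := (measurePreserving_add_right (volume : Measure ℝ) h).setIntegral_preimage_emb
    (MeasurableEquiv.addRight h).measurableEmbedding f (Ioi (a + h))
  simpa using this

theorem integrable_of_norm_le_inv_one_add_sq {f : ℝ → ℂ} (hf : Continuous f) {M : ℝ}
    (hM : ∀ s, ‖f s‖ ≤ M * (1 + s ^ 2)⁻¹) : Integrable f :=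
  (integrable_inv_one_add_sq.const_mul M).mono' hf.aestronglyMeasurable
    (Eventually.of_forall hM)

theorem norm_integral_Ioi_le_inv_pow {f : ℝ → ℂ} {M y : ℝ} (hM : 0 ≤ M) (hy : 0 ≤ y) (n : ℕ)
    (hf : ∀ s, 0 ≤ s → ‖f s‖ ≤ M * ((1 + s) ^ (n + 2))⁻¹) :
    ‖∫ s in Ioi y, f s‖ ≤ M * ((1 + y) ^ (n + 1))⁻¹ := by
  have hd : ∀ x ∈ Ici y, HasDerivAt (fun s : ℝ => -((n + 1 : ℝ)⁻¹ * ((1 + s) ^ (n + 1))⁻¹))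
      (((1 + x) ^ (n + 2))⁻¹) x := by
    intro x hx
    have hx0 : 0 < 1 + x := by have := hy.trans hx; linarith
    have h1 : HasDerivAt (fun s : ℝ => (1 + s) ^ (n + 1)) (((n + 1 : ℕ) : ℝ) * (1 + x) ^ n * 1) x :=
      ((hasDerivAt_id x).const_add 1).pow (n + 1)
    refine ((h1.inv (pow_pos hx0 _).ne').const_mul ((n + 1 : ℝ)⁻¹)).neg.congr_deriv ?_
    have hn : (n + 1 : ℝ) ≠ 0 := by positivity
    push_cast
    field_simp
    ring
  have ht : Tendsto (fun s : ℝ => -((n + 1 : ℝ)⁻¹ * ((1 + s) ^ (n + 1))⁻¹)) atTop (nhds 0) := by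
    have h2 : Tendsto (fun s : ℝ => ((1 + s) ^ (n + 1))⁻¹) atTop (nhds 0) :=
      ((tendsto_pow_atTop (Nat.succ_ne_zero n)).comp
        (tendsto_atTop_add_const_left _ 1 tendsto_id)).inv_tendsto_atTop
    simpa using (h2.const_mul ((n + 1 : ℝ)⁻¹)).neg
  have hp : ∀ x ∈ Ioi y, 0 ≤ ((1 + x) ^ (n + 2))⁻¹ := fun x hx => by
    have : 0 < x := hy.trans_lt hx
    positivity
  have hint := integrableOn_Ioi_deriv_of_nonneg' hd hp ht
  have hval := integral_Ioi_of_hasDerivAt_of_nonneg' hd hp ht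
  refine (norm_integral_le_of_norm_le (hint.const_mul M) ?_).trans ?_
  · filter_upwards [ae_restrict_mem measurableSet_Ioi] with s hs
    exact hf s (hy.trans (le_of_lt hs))
  · rw [integral_const_mul, hval, zero_sub, neg_neg]
    have : (n + 1 : ℝ)⁻¹ ≤ 1 := inv_le_one_of_one_le₀ (by linarith [n.cast_nonneg (α := ℝ)])
    gcongr
    exact mul_le_of_le_one_left (by positivity) this

theorem integral_Ioi_inv_one_add_sq_mul_exp_le {K : ℝ} (y : ℝ) :
    IntegrableOn (fun s => 2 * K * ((1 + s ^ 2)⁻¹ * Real.exp (-(2 * K * Real.arctan s)))) (Ioi y) ∧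
    ∫ s in Ioi y, 2 * K * ((1 + s ^ 2)⁻¹ * Real.exp (-(2 * K * Real.arctan s))) ≤
      Real.exp (-(2 * K * Real.arctan y)) := by
  have hi : Integrable
      (fun s => 2 * K * ((1 + s ^ 2)⁻¹ * Real.exp (-(2 * K * Real.arctan s)))) := by
    refine (integrable_inv_one_add_sq.mul_bdd (c := Real.exp (2 * |K| * (Real.pi / 2))) ?_ ?_).const_mul _
    · exact Continuous.aestronglyMeasurable (by fun_prop)
    · refine Eventually.of_forall fun s => ?_
      rw [Real.norm_eq_abs, Real.abs_exp, Real.exp_le_exp]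
      refine (le_abs_self _).trans ?_
      rw [abs_neg, abs_mul, abs_mul, abs_two]
      gcongr
      exact abs_le.2 ⟨(Real.neg_pi_div_two_lt_arctan s).le, (Real.arctan_lt_pi_div_two s).le⟩
  have hd : ∀ x ∈ Ici y, HasDerivAt (fun s => -Real.exp (-(2 * K * Real.arctan s)))
      (2 * K * ((1 + x ^ 2)⁻¹ * Real.exp (-(2 * K * Real.arctan x)))) x := fun x _ =>
    (((Real.hasDerivAt_arctan' x).const_mul (2 * K)).neg.exp.neg).congr_deriv (by
      simp only [Pi.neg_apply]
      ring)
  have ht : Tendsto (fun s => -Real.exp (-(2 * K * Real.arctan s))) atTop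
      (nhds (-Real.exp (-(2 * K * (Real.pi / 2))))) :=
    (((Real.tendsto_arctan_atTop.mono_right nhdsWithin_le_nhds).const_mul (2 * K)).neg.rexp).neg
  refine ⟨hi.integrableOn, ?_⟩
  rw [integral_Ioi_of_hasDerivAt_of_tendsto' hd hi.integrableOn ht]
  linarith [Real.exp_pos (-(2 * K * (Real.pi / 2)))]

theorem norm_exp_I_mul (s : ℝ) : ‖Complex.exp (Complex.I * s)‖ = 1 := by
  rw [mul_comm, Complex.norm_exp_ofReal_mul_I]

theorem norm_exp_neg_I_mul (s : ℝ) : ‖Complex.exp (-(Complex.I * s))‖ = 1 := by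
  rw [← mul_neg, ← Complex.ofReal_neg, norm_exp_I_mul]

theorem integrable_exp_I_mul {f : ℝ → ℂ} (hf : Integrable f) :
    Integrable fun s : ℝ => Complex.exp (Complex.I * s) * f s :=
  hf.bdd_mul (c := 1) (Continuous.aestronglyMeasurable (by fun_prop))
    (Eventually.of_forall fun s => (norm_exp_I_mul s).le)

theorem integrable_exp_neg_I_mul {f : ℝ → ℂ} (hf : Integrable f) :
    Integrable fun s : ℝ => Complex.exp (-(Complex.I * s)) * f s :=
  hf.bdd_mul (c := 1) (Continuous.aestronglyMeasurable (by fun_prop))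
    (Eventually.of_forall fun s => (norm_exp_neg_I_mul s).le)

/-- The sine convolution over a half-line, split into its two oscillating parts. -/
theorem integral_Ioi_sin_sub_mul {f : ℝ → ℂ} (hf : Integrable f) (y : ℝ) :
    ∫ s in Ioi y, (Real.sin (s - y) : ℂ) * f s =
      (Complex.exp (-(Complex.I * y)) * (∫ s in Ioi y, Complex.exp (Complex.I * s) * f s)
        - Complex.exp (Complex.I * y) * ∫ s in Ioi y, Complex.exp (-(Complex.I * s)) * f s)
        / (2 * Complex.I) := by
  have h1 := integrable_exp_I_mul hf
  have h2 := integrable_exp_neg_I_mul hf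
  rw [← integral_const_mul, ← integral_const_mul, ← integral_sub
    (h1.integrableOn.const_mul _) (h2.integrableOn.const_mul _), ← integral_div]
  refine integral_congr_ae (Eventually.of_forall fun s => ?_)
  simp only
  rw [← mul_assoc, ← mul_assoc, ← Complex.exp_add, ← Complex.exp_add, ← sub_mul, mul_div_right_comm]
  congr 1
  push_cast
  rw [Complex.sin]
  rw [show -(Complex.I * (y : ℂ)) + Complex.I * s = (s - y) * Complex.I by ring,
    show Complex.I * (y : ℂ) + -(Complex.I * s) = -(s - y) * Complex.I by ring]
  field_simp
  ring_nf
  simp [Complex.I_sq]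

theorem continuous_integral_Ioi {f : ℝ → ℂ} (hf : Continuous f) (hi : Integrable f) :
    Continuous fun y : ℝ => ∫ s in Ioi y, f s :=
  continuous_iff_continuousAt.2 fun y => (hasDerivAt_integral_Ioi hf hi y).continuousAt

theorem continuous_integral_Ioi_sin_sub_mul {f : ℝ → ℂ} (hf : Continuous f) (hi : Integrable f) :
    Continuous fun y : ℝ => ∫ s in Ioi y, (Real.sin (s - y) : ℂ) * f s := by
  simp only [integral_Ioi_sin_sub_mul hi]
  have h1 := continuous_integral_Ioi (by fun_prop) (integrable_exp_I_mul hi)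
  have h2 := continuous_integral_Ioi (by fun_prop) (integrable_exp_neg_I_mul hi)
  fun_prop

end TailIntegrals

section Volterra

open MeasureTheory BoundedContinuousFunction

theorem norm_exp_mul_integral_Ioi_sin_sub_mul_le {V : ℝ → ℝ} {K : ℝ} (hK : 0 ≤ K)
    (hV : ∀ y, |V y| ≤ K * (1 + y ^ 2)⁻¹) {b : ℝ → ℂ} {B : ℝ} (hB : ∀ s, ‖b s‖ ≤ B) (y : ℝ) :
    ‖(Real.exp (2 * K * Real.arctan y) : ℂ) * ∫ s in Ioi y, (Real.sin (s - y) : ℂ) *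
      (V s * Real.exp (-(2 * K * Real.arctan s)) * b s)‖ ≤ B / 2 := by
  have hB0 : 0 ≤ B := (norm_nonneg _).trans (hB 0)
  obtain ⟨hi, hle⟩ := integral_Ioi_inv_one_add_sq_mul_exp_le (K := K) y
  have h : ‖∫ s in Ioi y, (Real.sin (s - y) : ℂ) *
      (V s * Real.exp (-(2 * K * Real.arctan s)) * b s)‖ ≤
      B / 2 * Real.exp (-(2 * K * Real.arctan y)) := by
    refine (norm_integral_le_of_norm_le (hi.const_mul (B / 2)) (Eventually.of_forall fun s => ?_)).trans ?_
    · rw [norm_mul, norm_mul, norm_mul, Complex.norm_real, Complex.norm_real, Complex.norm_real,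
        Real.norm_eq_abs, Real.norm_eq_abs, Real.norm_eq_abs, Real.abs_exp]
      calc |Real.sin (s - y)| * (|V s| * Real.exp (-(2 * K * Real.arctan s)) * ‖b s‖)
          ≤ 1 * (K * (1 + s ^ 2)⁻¹ * Real.exp (-(2 * K * Real.arctan s)) * B) := by
            gcongr
            exacts [Real.abs_sin_le_one _, hV s, hB s]
        _ = _ := by ring
    · rw [integral_const_mul]
      gcongr
  rw [norm_mul, Complex.norm_real, Real.norm_eq_abs, Real.abs_exp]
  calc _ ≤ Real.exp (2 * K * Real.arctan y) * (B / 2 * Real.exp (-(2 * K * Real.arctan y))) := by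
        gcongr
    _ = B / 2 * (Real.exp (2 * K * Real.arctan y) * Real.exp (-(2 * K * Real.arctan y))) := by ring
    _ = B / 2 := by rw [← Real.exp_add, add_neg_cancel, Real.exp_zero, mul_one]

/-- The Volterra equation for the Jost solution at `+∞` has a bounded continuous solution, with a
bound depending only on the size of the potential. -/
theorem exists_bounded_volterra_solution {V : ℝ → ℝ} (hVc : Continuous V) {K : ℝ} (hK : 0 ≤ K)
    (hV : ∀ y, |V y| ≤ K * (1 + y ^ 2)⁻¹) :
    ∃ v : ℝ → ℂ, Continuous v ∧ (∀ y, ‖v y‖ ≤ 2 * Real.exp (2 * K * Real.pi)) ∧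
      ∀ y : ℝ, v y = Complex.exp (Complex.I * y) +
        ∫ s in Ioi y, (Real.sin (s - y) : ℂ) * (V s * v s) := by
  set ρ : ℝ → ℝ := fun y => Real.exp (2 * K * Real.arctan y) with hρ
  set g : (ℝ → ℂ) → ℝ → ℂ := fun b s => V s * Real.exp (-(2 * K * Real.arctan s)) * b s with hg
  have hexp : ∀ σ : ℝ, |σ| = 1 → ∀ s,
      σ * (2 * K * Real.arctan s) ≤ K * Real.pi := by
    intro σ hσ s
    refine (le_abs_self _).trans ?_
    rw [abs_mul, hσ, one_mul, abs_mul, abs_of_nonneg (by positivity : 0 ≤ 2 * K)]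
    have : |Real.arctan s| ≤ Real.pi / 2 :=
      abs_le.2 ⟨(Real.neg_pi_div_two_lt_arctan s).le, (Real.arctan_lt_pi_div_two s).le⟩
    nlinarith
  have hρle : ∀ s, ρ s ≤ Real.exp (K * Real.pi) := fun s =>
    Real.exp_le_exp.2 (by simpa using hexp 1 (by simp) s)
  have hρinv : ∀ s, -(2 * K * Real.arctan s) ≤ K * Real.pi :=
    fun s => by simpa using hexp (-1) (by simp) s
  have hgc : ∀ b : ℝ →ᵇ ℂ, Continuous (g b) := fun b => by
    have := b.continuous
    fun_prop
  have hgi : ∀ b : ℝ →ᵇ ℂ, Integrable (g b) := fun b => by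
    refine integrable_of_norm_le_inv_one_add_sq (hgc b)
      (M := K * Real.exp (K * Real.pi) * ‖b‖) fun s => ?_
    simp only [hg, norm_mul, Complex.norm_real, Real.norm_eq_abs, Real.abs_exp]
    calc |V s| * Real.exp (-(2 * K * Real.arctan s)) * ‖b s‖
        ≤ K * (1 + s ^ 2)⁻¹ * Real.exp (K * Real.pi) * ‖b‖ := by
          gcongr
          exacts [hV s, hρinv s, b.norm_coe_le_norm s]
      _ = _ := by ring
  have hρnorm : ∀ y, ‖(ρ y : ℂ) * Complex.exp (Complex.I * y)‖ ≤ Real.exp (K * Real.pi) := by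
    intro y
    rw [norm_mul, norm_exp_I_mul, mul_one, Complex.norm_real, Real.norm_eq_abs, Real.abs_exp]
    exact hρle y
  have hhalf : ∀ (b : ℝ →ᵇ ℂ) (y : ℝ),
      ‖(ρ y : ℂ) * ∫ s in Ioi y, (Real.sin (s - y) : ℂ) * g b s‖ ≤ ‖b‖ / 2 := fun b y =>
    norm_exp_mul_integral_Ioi_sin_sub_mul_le hK hV b.norm_coe_le_norm y
  let T : (ℝ →ᵇ ℂ) → (ℝ →ᵇ ℂ) := fun b =>
    BoundedContinuousFunction.ofNormedAddCommGroup
      (fun y : ℝ => (ρ y : ℂ) * Complex.exp (Complex.I * y) +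
        ρ y * ∫ s in Ioi y, (Real.sin (s - y) : ℂ) * g b s)
      (by
        have := continuous_integral_Ioi_sin_sub_mul (hgc b) (hgi b)
        fun_prop)
      (Real.exp (K * Real.pi) + ‖b‖ / 2)
      (fun y => (norm_add_le _ _).trans (add_le_add (hρnorm y) (hhalf b y)))
  have hTapp : ∀ (b : ℝ →ᵇ ℂ) (y : ℝ), T b y = (ρ y : ℂ) * Complex.exp (Complex.I * y) +
        ρ y * ∫ s in Ioi y, (Real.sin (s - y) : ℂ) * g b s := fun b y => rfl
  have hsin : ∀ (b : ℝ →ᵇ ℂ) (y : ℝ),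
      IntegrableOn (fun s => (Real.sin (s - y) : ℂ) * g b s) (Ioi y) := fun b y =>
    ((hgi b).bdd_mul (c := 1) (Continuous.aestronglyMeasurable (by fun_prop))
      (Eventually.of_forall fun s => by
        rw [Complex.norm_real]; exact Real.abs_sin_le_one _)).integrableOn
  have hT : ContractingWith (1 / 2 : NNReal) T := by
    refine ⟨by rw [← NNReal.coe_lt_coe]; norm_num, LipschitzWith.of_dist_le_mul fun b c => ?_⟩
    rw [BoundedContinuousFunction.dist_le (by positivity)]
    intro y
    have h := hhalf (b - c) y
    have hgsub : ∀ s, (Real.sin (s - y) : ℂ) * g (b - c : ℝ →ᵇ ℂ) s =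
        Real.sin (s - y) * g b s - Real.sin (s - y) * g c s := fun s => by
      simp only [hg, BoundedContinuousFunction.coe_sub, Pi.sub_apply]
      ring
    simp only [hgsub] at h
    rw [integral_sub (hsin b y) (hsin c y), mul_sub] at h
    rw [dist_eq_norm, dist_eq_norm, hTapp, hTapp, add_sub_add_left_eq_sub]
    refine h.trans (le_of_eq ?_)
    push_cast
    ring
  obtain ⟨b, hb⟩ : ∃ b, T b = b := ⟨_, hT.fixedPoint_isFixedPt⟩
  have hbn : ‖b‖ ≤ 2 * Real.exp (K * Real.pi) := by
    have : ‖b‖ ≤ Real.exp (K * Real.pi) + ‖b‖ / 2 := by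
      conv_lhs => rw [← hb]
      exact BoundedContinuousFunction.norm_ofNormedAddCommGroup_le _ (by positivity) _
    linarith
  refine ⟨fun y => Real.exp (-(2 * K * Real.arctan y)) * b y, ?_, fun y => ?_, fun y => ?_⟩
  · have := b.continuous
    fun_prop
  · rw [norm_mul, Complex.norm_real, Real.norm_eq_abs, Real.abs_exp]
    calc _ ≤ Real.exp (K * Real.pi) * (2 * Real.exp (K * Real.pi)) := by
          gcongr
          exacts [hρinv y, (b.norm_coe_le_norm y).trans hbn]
      _ = 2 * (Real.exp (K * Real.pi) * Real.exp (K * Real.pi)) := by ring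
      _ = _ := by rw [← Real.exp_add]; ring_nf
  · have hone : (Real.exp (-(2 * K * Real.arctan y)) : ℂ) * ρ y = 1 := by
      rw [← Complex.ofReal_mul, ← Real.exp_add, neg_add_cancel, Real.exp_zero, Complex.ofReal_one]
    have h := hTapp b y
    rw [hb, ← mul_add] at h
    beta_reduce
    rw [h, ← mul_assoc, hone, one_mul]
    simp only [hg, mul_assoc]

end Volterra

section JostCoefficients

open MeasureTheory

theorem norm_integral_Ioi_le_integral_norm {f : ℝ → ℂ} (hf : Integrable f) (y : ℝ) :
    ‖∫ s in Ioi y, f s‖ ≤ ∫ s, ‖f s‖ :=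
  (norm_integral_le_integral_norm _).trans
    (setIntegral_le_integral hf.norm (Eventually.of_forall fun _ => norm_nonneg _))

theorem norm_integral_Ioi_exp_sq_mul_le {F : ℝ → ℂ} (hFi : Integrable F)
    {y E D : ℝ} (hy : 0 ≤ y) (hE : 0 ≤ E) (hD : 0 ≤ D)
    (hF : ∀ s, 0 ≤ s → ‖F s‖ ≤ E * ((1 + s) ^ 2)⁻¹)
    (hF' : ∀ s, 0 ≤ s → ‖F s - F (s + Real.pi / 2)‖ ≤ D * ((1 + s) ^ 3)⁻¹) :
    ‖∫ s in Ioi y, Complex.exp (Complex.I * s) * (Complex.exp (Complex.I * s) * F s)‖ ≤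
      (E * (Real.pi / 2) + D) * ((1 + y) ^ 2)⁻¹ := by
  set h : ℝ := Real.pi / 2 with hh
  have hh0 : 0 < h := by positivity
  set g : ℝ → ℂ := fun s => Complex.exp (Complex.I * s) * (Complex.exp (Complex.I * s) * F s) with hg
  have hgi : Integrable g := integrable_exp_I_mul (integrable_exp_I_mul hFi)
  have hshift : ∀ s, g s + g (s + h) =
      Complex.exp (Complex.I * s) * (Complex.exp (Complex.I * s) * (F s - F (s + h))) := by
    intro s
    have : Complex.exp (Complex.I * ((s + h : ℝ) : ℂ)) = Complex.I * Complex.exp (Complex.I * s) := by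
      rw [Complex.ofReal_add, mul_add, Complex.exp_add, hh]
      push_cast
      rw [mul_comm Complex.I (Real.pi / 2 : ℂ), Complex.exp_pi_div_two_mul_I, mul_comm]
    simp only [hg, this]
    linear_combination (Complex.exp (Complex.I * s)) ^ 2 * F (s + h) * Complex.I_sq
  have hsplit : 2 * ∫ s in Ioi y, g s = (∫ s in y..(y + h), g s) + ∫ s in Ioi y, (g s + g (s + h)) := by
    rw [integral_add hgi.integrableOn (hgi.comp_add_right h).integrableOn,
      setIntegral_Ioi_comp_add_right, ← intervalIntegral.integral_Ioi_sub_Ioi hgi.integrableOn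
      (by linarith)]
    ring
  have h1 : ‖∫ s in y..(y + h), g s‖ ≤ E * ((1 + y) ^ 2)⁻¹ * h := by
    refine (intervalIntegral.norm_integral_le_of_norm_le_const (C := E * ((1 + y) ^ 2)⁻¹)
      fun s hs => ?_).trans_eq (by rw [add_sub_cancel_left, abs_of_pos hh0])
    rw [uIoc_of_le (by linarith)] at hs
    rw [hg, norm_mul, norm_mul, norm_exp_I_mul, one_mul, one_mul]
    have hs1 := hs.1.le
    refine (hF s (hy.trans hs1)).trans ?_
    gcongr
  have h2 : ‖∫ s in Ioi y, (g s + g (s + h))‖ ≤ D * ((1 + y) ^ 2)⁻¹ := by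
    refine norm_integral_Ioi_le_inv_pow hD hy 1 fun s hs => ?_
    rw [hshift, norm_mul, norm_mul, norm_exp_I_mul, one_mul, one_mul]
    exact hF' s hs
  have h3 : 2 * ‖∫ s in Ioi y, g s‖ ≤ E * ((1 + y) ^ 2)⁻¹ * h + D * ((1 + y) ^ 2)⁻¹ := by
    calc 2 * ‖∫ s in Ioi y, g s‖ = ‖2 * ∫ s in Ioi y, g s‖ := by rw [norm_mul, Complex.norm_two]
      _ ≤ _ := by rw [hsplit]; exact (norm_add_le _ _).trans (add_le_add h1 h2)
  linarith [norm_nonneg (∫ s in Ioi y, g s)]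

theorem inv_one_add_sq_le {s : ℝ} (hs : 0 ≤ s) : (1 + s ^ 2)⁻¹ ≤ 2 * ((1 + s) ^ 2)⁻¹ := by
  rw [← div_eq_mul_inv, inv_eq_one_div, div_le_div_iff₀ (by positivity) (by positivity)]
  nlinarith [sq_nonneg (s - 1)]

/-- For a Lipschitz potential of size `⟨y⟩⁻²` there is a Jost solution at `+∞`, whose coefficients
with respect to `e^{±iy}`, obtained from `(v, v')` by the rotation, satisfy bounds depending only
on the constants for the potential. -/
theorem exists_jost_solution {K L : ℝ} (hK : 0 ≤ K) (hL : 0 ≤ L) :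
    ∃ M > (0 : ℝ), ∀ V : ℝ → ℝ, Continuous V → (∀ y, |V y| ≤ K * (1 + y ^ 2)⁻¹) →
      (∀ x y, 0 ≤ x → x ≤ y → |V y - V x| ≤ L * ((1 + x) ^ 3)⁻¹ * (y - x)) →
      ∃ v dv a b : ℝ → ℂ,
        (∀ y, HasDerivAt v (dv y) y ∧ HasDerivAt dv (((V y - 1 : ℝ) : ℂ) * v y) y) ∧
        (∀ y : ℝ, v y = a y * Complex.exp (Complex.I * y) + b y * Complex.exp (-(Complex.I * y))) ∧
        (∀ y : ℝ, dv y = Complex.I *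
          (a y * Complex.exp (Complex.I * y) - b y * Complex.exp (-(Complex.I * y)))) ∧
        ∀ y, 0 ≤ y → ‖a y - 1‖ ≤ M * (1 + y)⁻¹ ∧ ‖b y‖ ≤ M * ((1 + y) ^ 2)⁻¹ := by
  set N : ℝ := 2 * K * (2 * Real.exp (2 * K * Real.pi)) with hN
  have hN0 : 0 ≤ N := by positivity
  set D : ℝ := L * (Real.pi / 2) * (1 + N) + 4 * K * N with hD
  have hD0 : 0 ≤ D := by positivity
  set M : ℝ := 2 * K * (1 + N) * (Real.pi / 2) + D + 2 * K * N with hM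
  have hM0 : 0 ≤ M := by positivity
  refine ⟨M + N + 1, by positivity, fun V hVc hV hVL => ?_⟩
  obtain ⟨v, hvc, hvB, hv⟩ := exists_bounded_volterra_solution hVc hK hV
  have hV2 : ∀ s, 0 ≤ s → |V s| ≤ 2 * K * ((1 + s) ^ 2)⁻¹ := fun s hs =>
    (hV s).trans (by linarith [mul_le_mul_of_nonneg_left (inv_one_add_sq_le hs) hK])
  set f : ℝ → ℂ := fun s => V s * v s with hf
  have hfc : Continuous f := by fun_prop
  have hfn : ∀ s, ‖f s‖ = |V s| * ‖v s‖ := fun s => by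
    rw [hf, norm_mul, Complex.norm_real, Real.norm_eq_abs]
  have hfi : Integrable f := by
    refine integrable_of_norm_le_inv_one_add_sq hfc (M := K * (2 * Real.exp (2 * K * Real.pi)))
      fun s => ?_
    rw [hfn, mul_right_comm]
    exact mul_le_mul (hV s) (hvB s) (norm_nonneg _) ((abs_nonneg _).trans (hV s))
  have hfN : ∀ s, 0 ≤ s → ‖f s‖ ≤ N * ((1 + s) ^ (0 + 2))⁻¹ := fun s hs => by
    rw [hfn, hN, mul_right_comm]
    exact mul_le_mul (hV2 s hs) (hvB s) (norm_nonneg _) ((abs_nonneg _).trans (hV2 s hs))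
  have hpi := integrable_exp_neg_I_mul hfi
  have hqi := integrable_exp_I_mul hfi
  set p : ℝ → ℂ := fun y => ∫ s in Ioi y, Complex.exp (-(Complex.I * s)) * f s with hp
  set q : ℝ → ℂ := fun y => ∫ s in Ioi y, Complex.exp (Complex.I * s) * f s with hq
  have hpd : ∀ y : ℝ, HasDerivAt p (-(Complex.exp (-(Complex.I * y)) * f y)) y :=
    hasDerivAt_integral_Ioi (by fun_prop) hpi
  have hqd : ∀ y : ℝ, HasDerivAt q (-(Complex.exp (Complex.I * y) * f y)) y :=
    hasDerivAt_integral_Ioi (by fun_prop) hqi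
  have hpN : ∀ y, 0 ≤ y → ‖p y‖ ≤ N * (1 + y)⁻¹ := fun y hy => by
    have := norm_integral_Ioi_le_inv_pow (f := fun s : ℝ => Complex.exp (-(Complex.I * s)) * f s)
      hN0 hy 0 fun s hs => by rw [norm_mul, norm_exp_neg_I_mul, one_mul]; exact hfN s hs
    simpa using this
  have hqN : ∀ y, 0 ≤ y → ‖q y‖ ≤ N * (1 + y)⁻¹ := fun y hy => by
    have := norm_integral_Ioi_le_inv_pow (f := fun s : ℝ => Complex.exp (Complex.I * s) * f s)
      hN0 hy 0 fun s hs => by rw [norm_mul, norm_exp_I_mul, one_mul]; exact hfN s hs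
    simpa using this
  have hhalf : ∀ z : ℂ, ‖z / (2 * Complex.I)‖ ≤ ‖z‖ := fun z => by
    rw [norm_div, norm_mul, Complex.norm_I, Complex.norm_two]
    linarith [norm_nonneg z]
  set a : ℝ → ℂ := fun y => 1 - p y / (2 * Complex.I) with ha
  set b : ℝ → ℂ := fun y => q y / (2 * Complex.I) with hb
  have had : ∀ y : ℝ, HasDerivAt a (Complex.exp (-(Complex.I * y)) * f y / (2 * Complex.I)) y :=
    fun y => (((hpd y).div_const _).const_sub 1).congr_deriv (by ring)
  have hbd : ∀ y : ℝ, HasDerivAt b (-(Complex.exp (Complex.I * y) * f y) / (2 * Complex.I)) y :=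
    fun y => (hqd y).div_const _
  have hac : Continuous a := continuous_iff_continuousAt.2 fun y => (had y).continuousAt
  have hbc : Continuous b := continuous_iff_continuousAt.2 fun y => (hbd y).continuousAt
  have haN : ∀ y, 0 ≤ y → ‖a y - 1‖ ≤ N * (1 + y)⁻¹ := fun y hy => by
    rw [ha, sub_sub_cancel_left, norm_neg]
    exact (hhalf _).trans (hpN y hy)
  have hbN : ∀ y, 0 ≤ y → ‖b y‖ ≤ N * (1 + y)⁻¹ := fun y hy => (hhalf _).trans (hqN y hy)
  have ha1 : ∀ y, 0 ≤ y → ‖a y‖ ≤ 1 + N := fun y hy => by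
    have h1 : ‖a y‖ ≤ ‖a y - 1‖ + ‖(1 : ℂ)‖ := by simpa using norm_add_le (a y - 1) 1
    have h2 : (1 + y)⁻¹ ≤ 1 := inv_le_one_of_one_le₀ (by linarith)
    have h3 := mul_le_of_le_one_right hN0 h2
    rw [norm_one] at h1
    linarith [haN y hy]
  have hexp : ∀ y : ℝ, Complex.exp (Complex.I * y) * Complex.exp (-(Complex.I * y)) = 1 := fun y => by
    rw [← Complex.exp_add, add_neg_cancel, Complex.exp_zero]
  have hdec : ∀ y : ℝ, v y = a y * Complex.exp (Complex.I * y) +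
      b y * Complex.exp (-(Complex.I * y)) := fun y => by
    rw [hv y, integral_Ioi_sin_sub_mul hfi]
    simp only [ha, hb, hp, hq]
    ring
  have hed : ∀ y : ℝ, HasDerivAt (fun y : ℝ => Complex.exp (Complex.I * y))
      (Complex.exp (Complex.I * y) * Complex.I) y := fun y =>
    (((Complex.ofRealCLM.hasDerivAt (x := y)).const_mul Complex.I).cexp).congr_deriv (by simp)
  have hed' : ∀ y : ℝ, HasDerivAt (fun y : ℝ => Complex.exp (-(Complex.I * y)))
      (Complex.exp (-(Complex.I * y)) * -Complex.I) y := fun y =>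
    (((Complex.ofRealCLM.hasDerivAt (x := y)).const_mul Complex.I).neg.cexp).congr_deriv (by simp)
  have hI : (2 * Complex.I)⁻¹ * (2 * Complex.I) = 1 := inv_mul_cancel₀ (by simp)
  refine ⟨v, fun y => Complex.I *
    (a y * Complex.exp (Complex.I * y) - b y * Complex.exp (-(Complex.I * y))), a, b,
    fun y => ⟨?_, ?_⟩, hdec, fun _ => rfl, fun y hy => ⟨?_, ?_⟩⟩
  · rw [funext hdec]
    refine (((had y).mul (hed y)).add ((hbd y).mul (hed' y))).congr_deriv ?_
    ring
  · refine ((((had y).mul (hed y)).sub ((hbd y).mul (hed' y))).const_mul Complex.I).congr_deriv ?_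
    have hrhs : ((V y - 1 : ℝ) : ℂ) * v y = f y - (a y * Complex.exp (Complex.I * y) +
        b y * Complex.exp (-(Complex.I * y))) := by
      rw [← hdec y, Complex.ofReal_sub, Complex.ofReal_one, sub_mul (V y : ℂ), one_mul]
    rw [hrhs]
    linear_combination (f y * (2 * Complex.I)⁻¹ * (2 * Complex.I)) * hexp y + f y * hI +
      (a y * Complex.exp (Complex.I * y) + b y * Complex.exp (-(Complex.I * y))) * Complex.I_sq
  · exact (haN y hy).trans (by gcongr; linarith)
  · have hVi : Integrable fun s => (V s : ℂ) :=
      integrable_of_norm_le_inv_one_add_sq (by fun_prop) fun s => by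
        rw [Complex.norm_real]; exact hV s
    have hai : Integrable fun s => (V s : ℂ) * a s := by
      refine hVi.mul_bdd (c := 1 + ∫ s : ℝ, ‖Complex.exp (-(Complex.I * s)) * f s‖)
        hac.aestronglyMeasurable (Eventually.of_forall fun s => (norm_sub_le _ _).trans ?_)
      rw [norm_one]
      gcongr
      exact (hhalf _).trans (norm_integral_Ioi_le_integral_norm hpi s)
    have hbi : Integrable fun s => (V s : ℂ) * b s :=
      hVi.mul_bdd (c := ∫ s : ℝ, ‖Complex.exp (Complex.I * s) * f s‖)
        hbc.aestronglyMeasurable (Eventually.of_forall fun s =>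
          (hhalf _).trans (norm_integral_Ioi_le_integral_norm hqi s))
    have hsplit : q y = (∫ s in Ioi y, Complex.exp (Complex.I * s) *
        (Complex.exp (Complex.I * s) * (V s * a s))) + ∫ s in Ioi y, (V s : ℂ) * b s := by
      rw [← integral_add (integrable_exp_I_mul (integrable_exp_I_mul hai)).integrableOn
        hbi.integrableOn]
      refine integral_congr_ae (Eventually.of_forall fun s => ?_)
      simp only [hf]
      rw [hdec s]
      linear_combination V s * b s * hexp s
    have h1 := norm_integral_Ioi_exp_sq_mul_le (F := fun s => V s * a s) hai hy
      (E := 2 * K * (1 + N)) (D := D) (by positivity) hD0 (fun s hs => ?_) (fun s hs => ?_)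
    · have h2 : ‖∫ s in Ioi y, (V s : ℂ) * b s‖ ≤ 2 * K * N * ((1 + y) ^ 2)⁻¹ := by
        refine norm_integral_Ioi_le_inv_pow (by positivity) hy 1 fun s hs => ?_
        rw [norm_mul, Complex.norm_real]
        calc _ ≤ 2 * K * ((1 + s) ^ 2)⁻¹ * (N * (1 + s)⁻¹) :=
              mul_le_mul (hV2 s hs) (hbN s hs) (norm_nonneg _) (by positivity)
          _ = _ := by rw [pow_succ (1 + s) 2, mul_inv]; ring
      refine (hhalf _).trans ?_
      rw [hsplit]
      refine (norm_add_le _ _).trans ((add_le_add h1 h2).trans ?_)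
      rw [← add_mul]
      exact mul_le_mul_of_nonneg_right (by linarith) (by positivity)
    · rw [norm_mul, Complex.norm_real, mul_right_comm]
      exact mul_le_mul (hV2 s hs) (ha1 s hs) (norm_nonneg _) (by positivity)
    · have hs' : 0 ≤ s + Real.pi / 2 := by positivity
      have hle : s ≤ s + Real.pi / 2 := by linarith [Real.pi_pos]
      have hVs : ‖((V s - V (s + Real.pi / 2) : ℝ) : ℂ)‖ ≤ L * ((1 + s) ^ 3)⁻¹ * (Real.pi / 2) := by
        rw [Complex.norm_real, Real.norm_eq_abs, abs_sub_comm]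
        simpa using hVL s _ hs hle
      have hVs' : ‖(V (s + Real.pi / 2) : ℂ)‖ ≤ 2 * K * ((1 + s) ^ 2)⁻¹ := by
        rw [Complex.norm_real]
        refine (hV2 _ hs').trans ?_
        gcongr
      have has : ‖a s - a (s + Real.pi / 2)‖ ≤ 2 * N * (1 + s)⁻¹ := by
        have h3 : N * (1 + (s + Real.pi / 2))⁻¹ ≤ N * (1 + s)⁻¹ := by gcongr
        have h4 : ‖a s - a (s + Real.pi / 2)‖ ≤ ‖a s - 1‖ + ‖a (s + Real.pi / 2) - 1‖ := by
          simpa using norm_sub_le (a s - 1) (a (s + Real.pi / 2) - 1)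
        linarith [haN s hs, haN _ hs']
      have hrw : (V s : ℂ) * a s - V (s + Real.pi / 2) * a (s + Real.pi / 2) =
          ((V s - V (s + Real.pi / 2) : ℝ) : ℂ) * a s +
            V (s + Real.pi / 2) * (a s - a (s + Real.pi / 2)) := by
        push_cast
        ring
      simp only [hrw]
      refine (norm_add_le _ _).trans ?_
      rw [norm_mul, norm_mul]
      calc _ ≤ L * ((1 + s) ^ 3)⁻¹ * (Real.pi / 2) * (1 + N) +
            2 * K * ((1 + s) ^ 2)⁻¹ * (2 * N * (1 + s)⁻¹) :=
            add_le_add (mul_le_mul hVs (ha1 s hs) (norm_nonneg _) (by positivity))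
              (mul_le_mul hVs' has (norm_nonneg _) (by positivity))
        _ = D * ((1 + s) ^ 3)⁻¹ := by rw [hD, pow_succ (1 + s) 2, mul_inv]; ring

end JostCoefficients

theorem forall_of_forall_ne_zero {P : ℝ → Prop} (hP : IsClosed {l | P l})
    (h : ∀ l, l ≠ 0 → P l) (l : ℝ) : P l :=
  closure_minimal (s := {0}ᶜ) (fun m hm => h m hm) hP (dense_compl_singleton (0 : ℝ) l)

theorem one_add_sq_rpow_le {s : ℝ} (hs : 0 ≤ s) :
    (1 + s ^ 2) ^ (-(3 : ℝ) / 2) ≤ 8 * ((1 + s) ^ 3)⁻¹ := by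
  have h0 : (0 : ℝ) < 1 + s ^ 2 := by positivity
  have hr : √(1 + s ^ 2) ^ 3 = (1 + s ^ 2) ^ ((3 : ℝ) / 2) := by
    rw [Real.sqrt_eq_rpow, ← Real.rpow_natCast, ← Real.rpow_mul h0.le]
    norm_num
  have h1 : 1 + s ≤ 2 * √(1 + s ^ 2) := by
    have h2 : 1 ≤ √(1 + s ^ 2) := Real.one_le_sqrt.2 (by nlinarith)
    have h3 : s ≤ √(1 + s ^ 2) := Real.le_sqrt_of_sq_le (by linarith)
    linarith
  rw [neg_div, Real.rpow_neg h0.le, ← hr, ← div_eq_mul_inv, inv_eq_one_div,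
    div_le_div_iff₀ (by positivity) (by positivity), one_mul]
  calc (1 + s) ^ 3 ≤ (2 * √(1 + s ^ 2)) ^ 3 := by gcongr
    _ = _ := by ring

open Set Filter

/-- Existence of oscillating Jost-type solutions of `-v'' + W(y,λ) v = v` of the form
`v₊ = a₊₊ e^{iy} + a₊₋ e^{-iy}` with `a₊₊ → 1`, `a₊₋ → 0` as `y → +∞` uniformly in `λ`,
and `|a₊₋(y,λ)| ≲ ⟨y⟩^{-2}` for `y ≥ 0`. -/
theorem jost_solutions_short_range
    (W : ℝ → ℝ → ℝ)
    (hW_cont : Continuous (fun p : ℝ × ℝ => W p.1 p.2))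
    (hW_smooth : ContDiffOn ℝ (⊤ : ℕ∞) (fun p : ℝ × ℝ => W p.1 p.2) {p : ℝ × ℝ | p.2 ≠ 0})
    (hW_lam : ∀ α : ℕ, ∃ C > (0:ℝ), ∀ (y l : ℝ), l ≠ 0 →
      |iteratedDeriv α (fun s => W y s) l| ≤ C * |l| ^ (-(α:ℝ)) * (1 + y^2)⁻¹)
    (hW_y : ∃ C > (0:ℝ), ∀ (y l : ℝ),
      |deriv (fun s => W s l) y| ≤ C * (1 + y^2) ^ (-(3:ℝ)/2)) :
    ∃ v dv app apm : ℝ → ℝ → ℂ,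
      (∀ (l y : ℝ),
        HasDerivAt (fun s => v s l) (dv y l) y ∧
        HasDerivAt (fun s => dv s l) (((W y l : ℝ) - 1 : ℝ) * v y l) y) ∧
      (∀ (y l : ℝ), v y l = app y l * Complex.exp (Complex.I * (y : ℂ))
          + apm y l * Complex.exp (-(Complex.I * (y : ℂ)))) ∧
      TendstoUniformly (fun y l => app y l) (fun _ => (1:ℂ)) atTop ∧
      TendstoUniformly (fun y l => apm y l) (fun _ => (0:ℂ)) atTop ∧
      ∃ C > (0:ℝ), ∀ y : ℝ, 0 ≤ y → ∀ l : ℝ, ‖apm y l‖ ≤ C * (1 + y^2)⁻¹ := by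
  obtain ⟨K, hK0, hK⟩ := hW_lam 0
  obtain ⟨L, hL0, hL⟩ := hW_y
  have hWc : ∀ l, Continuous fun y => W y l := fun l =>
    hW_cont.comp (continuous_id.prodMk continuous_const)
  have hWc' : ∀ y, Continuous fun l => W y l := fun y =>
    hW_cont.comp (continuous_const.prodMk continuous_id)
  have hbound : ∀ l y, |W y l| ≤ K * (1 + y ^ 2)⁻¹ := fun l y => by
    refine forall_of_forall_ne_zero (P := fun l => |W y l| ≤ K * (1 + y ^ 2)⁻¹)
      (isClosed_le (hWc' y).abs continuous_const) (fun l hl => ?_) l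
    simpa using hK y l hl
  have hlip : ∀ l x y, 0 ≤ x → x ≤ y → |W y l - W x l| ≤ 8 * L * ((1 + x) ^ 3)⁻¹ * (y - x) := by
    intro l x y hx hxy
    refine forall_of_forall_ne_zero
      (P := fun l => |W y l - W x l| ≤ 8 * L * ((1 + x) ^ 3)⁻¹ * (y - x))
      (isClosed_le ((hWc' y).sub (hWc' x)).abs continuous_const) (fun l hl => ?_) l
    have hopen : IsOpen {p : ℝ × ℝ | p.2 ≠ 0} := isOpen_ne_fun continuous_snd continuous_const
    have hdiff : ∀ s, DifferentiableAt ℝ (fun s => W s l) s := fun s =>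
      DifferentiableAt.comp s (f := fun s : ℝ => (s, l))
        (((hW_smooth.contDiffAt (hopen.mem_nhds (x := (s, l)) hl)).differentiableAt (by simp)))
        (by fun_prop)
    have := (convex_Icc x y).norm_image_sub_le_of_norm_deriv_le (f := fun s => W s l)
      (C := 8 * L * ((1 + x) ^ 3)⁻¹) (fun s _ => hdiff s) (fun s hs => ?_)
      (left_mem_Icc.2 hxy) (right_mem_Icc.2 hxy)
    · rwa [Real.norm_eq_abs, Real.norm_eq_abs, abs_of_nonneg (sub_nonneg.2 hxy)] at this
    · refine (hL s l).trans ?_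
      have hxs := hs.1
      calc L * (1 + s ^ 2) ^ (-(3 : ℝ) / 2) ≤ L * (8 * ((1 + s) ^ 3)⁻¹) := by
            gcongr
            exact one_add_sq_rpow_le (hx.trans hxs)
        _ ≤ L * (8 * ((1 + x) ^ 3)⁻¹) := by gcongr
        _ = _ := by ring
  obtain ⟨M, hM0, hM⟩ := exists_jost_solution hK0.le (by positivity : 0 ≤ 8 * L)
  choose v dv a b hode hdec _ hab using fun l =>
    hM (fun y => W y l) (hWc l) (hbound l) (hlip l)
  have hlim : Tendsto (fun y : ℝ => M * (1 + y)⁻¹) atTop (nhds 0) := by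
    simpa using (tendsto_atTop_add_const_left _ (1 : ℝ) tendsto_id).inv_tendsto_atTop.const_mul M
  have hb : ∀ l y, 0 ≤ y → ‖b l y‖ ≤ M * (1 + y)⁻¹ := fun l y hy => by
    refine ((hab l y hy).2).trans ?_
    gcongr
    exact le_self_pow₀ (by linarith) two_ne_zero
  refine ⟨fun y l => v l y, fun y l => dv l y, fun y l => a l y, fun y l => b l y,
    hode, fun y l => hdec l y, ?_, ?_, M, hM0, fun y hy l => ?_⟩
  · rw [Metric.tendstoUniformly_iff]
    intro ε hε
    filter_upwards [hlim.eventually_lt_const hε, eventually_ge_atTop 0] with y hy hy0 l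
    rw [dist_comm, dist_eq_norm]
    exact ((hab l y hy0).1).trans_lt hy
  · rw [Metric.tendstoUniformly_iff]
    intro ε hε
    filter_upwards [hlim.eventually_lt_const hε, eventually_ge_atTop 0] with y hy hy0 l
    rw [dist_comm, dist_zero_right]
    exact (hb l y hy0).trans_lt hy
  · refine ((hab l y hy).2).trans ?_
    gcongr
    nlinarith
end

section
/- Let V satisfy |∂_x^α V(x)| ≲ ⟨x⟩^{-μ-α} (α = 0,1,2,3) and −V(x) ≳ ⟨x⟩^{-μ} with μ ∈ (0,2). Define U(x,λ) = V''(x)/(4(λ²−V(x))²) − 5(V'(x))²/(16(λ²−V(x))³) and W(y,λ) = U(x(y,λ),λ), where x(y,λ) is the inverse Liouville transform. Then |W(y,λ)| ≲ ⟨y⟩^{-2} and |∂_y W(y,λ)| ≲ ⟨y⟩^{-3} uniformly in y ∈ ℝ and λ ∈ ℝ. -/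
open Set intervalIntegral

/-- The symbol bounds on `V`, with the weight `⟨x⟩ ^ (-μ)` absorbed into `l² - V`. -/
lemma exists_abs_iteratedDeriv_mul_le {V : ℝ → ℝ} {μ : ℝ} {α : ℕ}
    (hV : ∃ C > (0:ℝ), ∀ x : ℝ, |iteratedDeriv α V x| ≤ C * (1 + x^2) ^ (-((μ + α)/2)))
    (hlow : ∃ c > (0:ℝ), ∀ x : ℝ, c * (1 + x^2) ^ (-(μ/2)) ≤ -V x) :
    ∃ D > (0:ℝ), ∀ l x : ℝ,
      |iteratedDeriv α V x| * Real.sqrt (1 + x^2) ^ α ≤ D * (l^2 - V x) := by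
  obtain ⟨C, hC, hV⟩ := hV
  obtain ⟨c, hc, hlow⟩ := hlow
  refine ⟨C / c, by positivity, fun l x => ?_⟩
  have hw : (0:ℝ) < 1 + x^2 := by positivity
  have hsplit : (1 + x^2) ^ (-((μ + α)/2)) * Real.sqrt (1 + x^2) ^ α
      = (1 + x^2) ^ (-(μ/2)) := by
    rw [Real.sqrt_eq_rpow, ← Real.rpow_mul_natCast hw.le, ← Real.rpow_add hw]
    congr 1
    ring
  calc |iteratedDeriv α V x| * Real.sqrt (1 + x^2) ^ α
      ≤ C * (1 + x^2) ^ (-((μ + α)/2)) * Real.sqrt (1 + x^2) ^ α := by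
        gcongr
        exact hV x
    _ = C / c * (c * (1 + x^2) ^ (-(μ/2))) := by
        rw [mul_assoc, hsplit]
        field_simp
    _ ≤ C / c * (l^2 - V x) := by
        gcongr
        linarith [hlow x, sq_nonneg l]

lemma hasDerivAt_mul_one_add_sq_rpow (p x : ℝ) :
    HasDerivAt (fun t : ℝ => t * (1 + t^2) ^ p)
      ((1 + x^2) ^ p * (1 + 2 * p * (x^2 / (1 + x^2)))) x := by
  have hw : (0:ℝ) < 1 + x^2 := by positivity
  have h1 : HasDerivAt (fun t : ℝ => 1 + t^2) (2 * x) x := by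
    simpa using (hasDerivAt_pow 2 x).const_add 1
  have h2 := (hasDerivAt_id x).mul (h1.rpow_const (p := p) (Or.inl hw.ne'))
  refine h2.congr_deriv ?_
  rw [Real.rpow_sub_one hw.ne']
  simp only [id]
  field_simp

lemma hasDerivAt_integral_sqrt {V : ℝ → ℝ} (hV : Continuous V) (l x : ℝ) :
    HasDerivAt (fun x => ∫ s in (0:ℝ)..x, Real.sqrt (l^2 - V s)) (Real.sqrt (l^2 - V x)) x := by
  have hc : Continuous fun s => Real.sqrt (l^2 - V s) := by fun_prop
  exact integral_hasDerivAt_right (hc.intervalIntegrable _ _)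
    (hc.stronglyMeasurableAtFilter _ _) hc.continuousAt

/-- A function that vanishes at `0` and whose derivative is dominated is itself dominated. -/
lemma sq_le_sq_of_hasDerivAt_le {f g f' g' : ℝ → ℝ} (hf : ∀ x, HasDerivAt f (f' x) x)
    (hg : ∀ x, HasDerivAt g (g' x) x) (hf0 : f 0 = 0) (hg0 : g 0 = 0)
    (hnonneg : ∀ x, 0 ≤ f' x) (hle : ∀ x, f' x ≤ g' x) (x : ℝ) : f x ^ 2 ≤ g x ^ 2 := by
  have hfm : Monotone f := monotone_of_hasDerivAt_nonneg hf hnonneg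
  have hgm : Monotone (fun x => g x - f x) :=
    monotone_of_hasDerivAt_nonneg (fun x => (hg x).sub (hf x)) fun x => sub_nonneg.2 (hle x)
  rcases le_total 0 x with hx | hx
  · have h1 := hfm hx
    have h2 := hgm hx
    simp only [hf0, hg0] at h1 h2
    nlinarith
  · have h1 := hfm hx
    have h2 := hgm hx
    simp only [hf0, hg0] at h1 h2
    nlinarith

/-- The Liouville variable `y` satisfies `⟨y⟩² ≲ ⟨x⟩² (l² - V x)`. -/
lemma exists_one_add_integral_sqrt_sq_le {V : ℝ → ℝ} {μ : ℝ} (hμ : μ ∈ Ioo (0:ℝ) 2)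
    (hV : Continuous V)
    (hup : ∃ C > (0:ℝ), ∀ x : ℝ, |V x| ≤ C * (1 + x^2) ^ (-(μ/2)))
    (hlow : ∃ c > (0:ℝ), ∀ x : ℝ, c * (1 + x^2) ^ (-(μ/2)) ≤ -V x) :
    ∃ M > (0:ℝ), ∀ l x : ℝ,
      1 + (∫ s in (0:ℝ)..x, Real.sqrt (l^2 - V s))^2 ≤ M * ((1 + x^2) * (l^2 - V x)) := by
  obtain ⟨C, hC, hup⟩ := hup
  obtain ⟨c, hc, hlow⟩ := hlow
  obtain ⟨hμ0, hμ2⟩ := hμ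
  have hδ : 0 < 1 - μ/2 := by linarith
  set K := Real.sqrt C / (1 - μ/2) with hK
  refine ⟨1 / c + 2 * (1 + K^2 / c), by positivity, fun l x => ?_⟩
  have hsq : ∀ t : ℝ, ((1 + t^2) ^ (-(μ/4)))^2 = (1 + t^2) ^ (-(μ/2)) := fun t => by
    rw [← Real.rpow_mul_natCast (by positivity)]
    congr 1
    push_cast
    ring
  have hg : ∀ t : ℝ, HasDerivAt (fun t => |l| * t + K * (t * (1 + t^2) ^ (-(μ/4))))
      (|l| + K * ((1 + t^2) ^ (-(μ/4)) * (1 + 2 * (-(μ/4)) * (t^2 / (1 + t^2))))) t := fun t => by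
    simpa using ((hasDerivAt_id t).const_mul |l|).fun_add
      ((hasDerivAt_mul_one_add_sq_rpow (-(μ/4)) t).const_mul K)
  have hle : ∀ t : ℝ, Real.sqrt (l^2 - V t)
      ≤ |l| + K * ((1 + t^2) ^ (-(μ/4)) * (1 + 2 * (-(μ/4)) * (t^2 / (1 + t^2)))) := fun t => by
    have hb : 0 < (1 + t^2) ^ (-(μ/4)) := by positivity
    have hfrac : t^2 / (1 + t^2) ≤ 1 := (div_le_one (by positivity)).2 (by linarith)
    have h1 : Real.sqrt (l^2 - V t) ≤ |l| + Real.sqrt C * (1 + t^2) ^ (-(μ/4)) := by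
      refine Real.sqrt_le_iff.2 ⟨by positivity, ?_⟩
      have h2 := (neg_abs_le (V t)).trans' (neg_le_neg (hup t))
      have h3 : 0 ≤ |l| * (Real.sqrt C * (1 + t^2) ^ (-(μ/4))) := by positivity
      rw [add_sq, sq_abs, mul_pow, Real.sq_sqrt hC.le, hsq]
      linarith
    have h4 : Real.sqrt C * (1 + t^2) ^ (-(μ/4))
        ≤ K * ((1 + t^2) ^ (-(μ/4)) * (1 + 2 * (-(μ/4)) * (t^2 / (1 + t^2)))) := by
      have : Real.sqrt C * (1 + t^2) ^ (-(μ/4)) = K * ((1 + t^2) ^ (-(μ/4)) * (1 - μ/2)) := by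
        rw [hK]
        field_simp
      rw [this]
      gcongr
      nlinarith
    linarith
  have hY := sq_le_sq_of_hasDerivAt_le (hasDerivAt_integral_sqrt hV l) hg (by simp) (by simp)
    (fun _ => Real.sqrt_nonneg _) hle x
  set a := (1 + x^2) ^ (-(μ/2)) with ha
  have ha0 : 0 < a := by positivity
  have hQ : c * a ≤ l^2 - V x := by linarith [hlow x, sq_nonneg l]
  have hQ0 : 0 < l^2 - V x := hQ.trans_lt' (by positivity)
  have hlQ : l^2 ≤ l^2 - V x := by nlinarith [hlow x]
  have haQ : a ≤ (l^2 - V x) / c := by rw [le_div_iff₀ hc]; linarith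
  have hone : 1 ≤ (1 + x^2) * a := by
    rw [ha, ← Real.rpow_one_add' (by positivity) (by linarith)]
    exact Real.one_le_rpow (by nlinarith) (by linarith)
  have hG : (|l| * x + K * (x * (1 + x^2) ^ (-(μ/4))))^2 ≤ 2 * (x^2 * (l^2 + K^2 * a)) := by
    rw [ha, ← hsq, ← sq_abs l]
    nlinarith [sq_nonneg (|l| * x - K * (x * (1 + x^2) ^ (-(μ/4))))]
  calc 1 + (∫ s in (0:ℝ)..x, Real.sqrt (l^2 - V s))^2
      ≤ (1 + x^2) * a + 2 * (x^2 * (l^2 + K^2 * a)) := add_le_add hone (hY.trans hG)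
    _ ≤ (1 + x^2) * ((l^2 - V x) / c)
        + 2 * ((1 + x^2) * ((l^2 - V x) + K^2 * ((l^2 - V x) / c))) := by
        gcongr
        linarith
    _ = (1 / c + 2 * (1 + K^2 / c)) * ((1 + x^2) * (l^2 - V x)) := by
        field_simp

/-- The inverse of a bijection of `ℝ` with positive derivative is differentiable. -/
lemma hasDerivAt_inverse_of_pos {f f' g : ℝ → ℝ} (hf : ∀ x, HasDerivAt f (f' x) x)
    (hpos : ∀ x, 0 < f' x) (hgf : ∀ x, g (f x) = x) (hfg : ∀ y, f (g y) = y) (y : ℝ) :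
    HasDerivAt g (f' (g y))⁻¹ y := by
  have hfm : StrictMono f := strictMono_of_hasDerivAt_pos hf hpos
  have hgm : Monotone g := fun a b hab => hfm.le_iff_le.1 (by rwa [hfg, hfg])
  have hgc : Continuous g := hgm.continuous_of_surjective fun x => ⟨f x, hgf x⟩
  exact HasDerivAt.of_local_left_inverse hgc.continuousAt (hf _) (hpos _).ne'
    (Filter.Eventually.of_forall hfg)

/-- The derivative of the effective potential in the original variable. -/
lemma hasDerivAt_effectivePotential {v v₁ v₂ : ℝ → ℝ} {v₃ k x : ℝ}
    (h0 : HasDerivAt v (v₁ x) x) (h1 : HasDerivAt v₁ (v₂ x) x) (h2 : HasDerivAt v₂ v₃ x)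
    (hne : k - v x ≠ 0) :
    HasDerivAt (fun t => v₂ t / (4 * (k - v t)^2) - 5 * (v₁ t)^2 / (16 * (k - v t)^3))
      (v₃ / (4 * (k - v x)^2) - v₁ x * v₂ x / (8 * (k - v x)^3)
        - 15 * (v₁ x)^3 / (16 * (k - v x)^4)) x := by
  have hQ : HasDerivAt (fun t => k - v t) (-v₁ x) x := h0.const_sub k
  have hA := h2.div ((hQ.fun_pow 2).const_mul 4) (by positivity)
  have hB := ((h1.fun_pow 2).const_mul 5).div ((hQ.fun_pow 3).const_mul 16) (by positivity)
  refine (hA.sub hB).congr_deriv ?_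
  field_simp
  ring

lemma abs_effectivePotential_le {v₁ v₂ r Q D : ℝ} (hr : 0 < r) (hQ : 0 < Q)
    (h1 : |v₁| * r ≤ D * Q) (h2 : |v₂| * r^2 ≤ D * Q) :
    |v₂ / (4 * Q^2) - 5 * v₁^2 / (16 * Q^3)| ≤ (D + D^2) * (r^2 * Q)⁻¹ := by
  have hb1 : |v₁| ≤ D * Q / r := (le_div_iff₀ hr).2 h1
  have hb2 : |v₂| ≤ D * Q / r^2 := (le_div_iff₀ (by positivity)).2 h2
  have hD : 0 ≤ D := nonneg_of_mul_nonneg_left ((by positivity : 0 ≤ |v₁| * r).trans h1) hQ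
  calc |v₂ / (4 * Q^2) - 5 * v₁^2 / (16 * Q^3)|
      ≤ |v₂ / (4 * Q^2)| + |5 * v₁^2 / (16 * Q^3)| := abs_sub _ _
    _ = |v₂| / (4 * Q^2) + 5 * |v₁|^2 / (16 * Q^3) := by
        simp [abs_div, abs_mul, abs_of_pos hQ]
    _ ≤ (D * Q / r^2) / (4 * Q^2) + 5 * (D * Q / r)^2 / (16 * Q^3) := by gcongr
    _ = (D / 4 + 5 * D^2 / 16) * (r^2 * Q)⁻¹ := by field_simp
    _ ≤ (D + D^2) * (r^2 * Q)⁻¹ := by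
        gcongr ?_ * _
        nlinarith [sq_nonneg D]

lemma abs_deriv_effectivePotential_le {v₁ v₂ v₃ r Q D : ℝ} (hr : 0 < r) (hQ : 0 < Q)
    (h1 : |v₁| * r ≤ D * Q) (h2 : |v₂| * r^2 ≤ D * Q) (h3 : |v₃| * r^3 ≤ D * Q) :
    |v₃ / (4 * Q^2) - v₁ * v₂ / (8 * Q^3) - 15 * v₁^3 / (16 * Q^4)|
      ≤ (D + D^2 + D^3) * (r^3 * Q)⁻¹ := by
  have hb1 : |v₁| ≤ D * Q / r := (le_div_iff₀ hr).2 h1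
  have hb2 : |v₂| ≤ D * Q / r^2 := (le_div_iff₀ (by positivity)).2 h2
  have hb3 : |v₃| ≤ D * Q / r^3 := (le_div_iff₀ (by positivity)).2 h3
  have hD : 0 ≤ D := nonneg_of_mul_nonneg_left ((by positivity : 0 ≤ |v₁| * r).trans h1) hQ
  calc |v₃ / (4 * Q^2) - v₁ * v₂ / (8 * Q^3) - 15 * v₁^3 / (16 * Q^4)|
      ≤ |v₃ / (4 * Q^2)| + |v₁ * v₂ / (8 * Q^3)| + |15 * v₁^3 / (16 * Q^4)| :=
        (abs_sub _ _).trans (by gcongr; exact abs_sub _ _)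
    _ = |v₃| / (4 * Q^2) + |v₁| * |v₂| / (8 * Q^3) + 15 * |v₁|^3 / (16 * Q^4) := by
        simp [abs_div, abs_mul, abs_of_pos hQ]
    _ ≤ (D * Q / r^3) / (4 * Q^2) + (D * Q / r) * (D * Q / r^2) / (8 * Q^3)
        + 15 * (D * Q / r)^3 / (16 * Q^4) := by gcongr
    _ = (D / 4 + D^2 / 8 + 15 * D^3 / 16) * (r^3 * Q)⁻¹ := by field_simp
    _ ≤ (D + D^2 + D^3) * (r^3 * Q)⁻¹ := by
        gcongr ?_ * _
        nlinarith [sq_nonneg D, pow_nonneg hD 3]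

/-- The effective potential `W(y,λ) = U(x(y,λ),λ)` arising from the Liouville transform,
with `U = V''/(4(λ²-V)²) - 5(V')²/(16(λ²-V)³)`, satisfies `|W| ≲ ⟨y⟩^{-2}` and
`|∂_y W| ≲ ⟨y⟩^{-3}` uniformly in `y ∈ ℝ` and `λ ∈ ℝ`. -/
theorem effective_potential_short_range
    (V : ℝ → ℝ) (μ : ℝ) (hμ : μ ∈ Ioo (0:ℝ) 2)
    (hV : ContDiff ℝ (⊤ : ℕ∞) V)
    (hVd : ∀ α : ℕ, α ≤ 3 → ∃ C > (0:ℝ), ∀ x : ℝ,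
      |iteratedDeriv α V x| ≤ C * (1 + x^2) ^ (-((μ + α)/2)))
    (hlow : ∃ c > (0:ℝ), ∀ x : ℝ, c * (1 + x^2) ^ (-(μ/2)) ≤ -V x)
    (xinv : ℝ → ℝ → ℝ)
    (hinv_left : ∀ (l x : ℝ),
      xinv (∫ s in (0:ℝ)..x, Real.sqrt (l^2 - V s)) l = x)
    (hinv_right : ∀ (l y : ℝ),
      (∫ s in (0:ℝ)..(xinv y l), Real.sqrt (l^2 - V s)) = y) :
    let U : ℝ → ℝ → ℝ := fun x l =>
      deriv (deriv V) x / (4 * (l^2 - V x)^2)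
        - 5 * (deriv V x)^2 / (16 * (l^2 - V x)^3)
    ∃ C > (0:ℝ), ∀ (y l : ℝ),
      |U (xinv y l) l| ≤ C * (1 + y^2)⁻¹ ∧
      |deriv (fun z => U (xinv z l) l) y| ≤ C * (1 + y^2) ^ (-(3:ℝ)/2) := by
  intro U
  have hup : ∃ C > (0:ℝ), ∀ x : ℝ, |V x| ≤ C * (1 + x^2) ^ (-(μ/2)) := by
    simpa using hVd 0 (by norm_num)
  obtain ⟨M, hM, hMle⟩ := exists_one_add_integral_sqrt_sq_le hμ hV.continuous hup hlow
  obtain ⟨D₁, hD₁, h1⟩ := exists_abs_iteratedDeriv_mul_le (hVd 1 (by norm_num)) hlow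
  obtain ⟨D₂, hD₂, h2⟩ := exists_abs_iteratedDeriv_mul_le (hVd 2 (by norm_num)) hlow
  obtain ⟨D₃, hD₃, h3⟩ := exists_abs_iteratedDeriv_mul_le (hVd 3 (by norm_num)) hlow
  simp only [iteratedDeriv_succ, iteratedDeriv_zero, pow_one] at h1 h2 h3
  have hpos : ∀ l x : ℝ, 0 < l^2 - V x := fun l x => by
    obtain ⟨c, hc, hlow⟩ := hlow
    have : 0 < c * (1 + x^2) ^ (-(μ/2)) := by positivity
    nlinarith [hlow x, sq_nonneg l]
  have hderiv : ∀ n : ℕ, ∀ x, HasDerivAt (iteratedDeriv n V) (iteratedDeriv (n + 1) V x) x :=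
    fun n x => by
      rw [iteratedDeriv_succ]
      exact ((hV.differentiable_iteratedDeriv n
        (by exact_mod_cast WithTop.coe_lt_top _)) x).hasDerivAt
  set D := D₁ + D₂ + D₃ with hD
  have hD0 : 0 < D := by positivity
  set E := D + D^2 + D^3
  have hE : 0 < E := by positivity
  refine ⟨E * M + E * M ^ ((3:ℝ)/2), by positivity, fun y l => ?_⟩
  set x := xinv y l with hx
  set r := Real.sqrt (1 + x^2) with hrdef
  set q := Real.sqrt (l^2 - V x) with hqdef
  have hr : 0 < r := by positivity
  have hQ : 0 < l^2 - V x := hpos l x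
  have hq : 0 < q := Real.sqrt_pos.2 hQ
  have hr2 : r^2 = 1 + x^2 := Real.sq_sqrt (by positivity)
  have hq2 : q^2 = l^2 - V x := Real.sq_sqrt hQ.le
  have hb1 : |deriv V x| * r ≤ D * (l^2 - V x) := (h1 l x).trans (by gcongr; linarith)
  have hb2 : |deriv (deriv V) x| * r^2 ≤ D * (l^2 - V x) :=
    (h2 l x).trans (by gcongr; linarith)
  have hb3 : |deriv (deriv (deriv V)) x| * r^3 ≤ D * (l^2 - V x) :=
    (h3 l x).trans (by gcongr; linarith)
  have hy : 1 + y^2 ≤ M * (r * q)^2 := by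
    have := hMle l x
    rwa [hinv_right, ← hr2, ← hq2, ← mul_pow] at this
  have hy0 : 0 < 1 + y^2 := by positivity
  constructor
  · calc |U x l| ≤ (D + D^2) * (r^2 * (l^2 - V x))⁻¹ := abs_effectivePotential_le hr hQ hb1 hb2
      _ = (D + D^2) * ((r * q)^2)⁻¹ := by rw [← hq2, mul_pow]
      _ ≤ E * (M * (1 + y^2)⁻¹) := by
        have : ((r * q)^2)⁻¹ ≤ M * (1 + y^2)⁻¹ := by
          rw [← div_eq_mul_inv, le_div_iff₀ hy0, inv_mul_le_iff₀ (by positivity)]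
          linarith
        gcongr
        exact le_add_of_nonneg_right (by positivity)
      _ ≤ (E * M + E * M ^ ((3:ℝ)/2)) * (1 + y^2)⁻¹ := by
        rw [← mul_assoc]
        gcongr
        exact le_add_of_nonneg_right (by positivity)
  · have hxinv : HasDerivAt (fun z => xinv z l) q⁻¹ y :=
      hasDerivAt_inverse_of_pos (hasDerivAt_integral_sqrt hV.continuous l)
        (fun t => Real.sqrt_pos.2 (hpos l t)) (hinv_left l) (hinv_right l) y
    have hU := hasDerivAt_effectivePotential (k := l^2) (hderiv 0 x) (hderiv 1 x) (hderiv 2 x)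
      (by simpa using hQ.ne')
    simp only [iteratedDeriv_succ, iteratedDeriv_zero] at hU
    have hW := hU.comp y hxinv
    have hrpow : (1 + y^2) ^ ((3:ℝ)/2) ≤ M ^ ((3:ℝ)/2) * (r * q)^3 := by
      have hcube : ((r * q)^2) ^ ((3:ℝ)/2) = (r * q)^3 := by
        rw [← Real.rpow_natCast_mul (by positivity), ← Real.rpow_natCast]
        norm_num
      rw [← hcube, ← Real.mul_rpow hM.le (by positivity)]
      gcongr
    rw [show deriv (fun z => U (xinv z l) l) y = _ from hW.deriv, abs_mul, abs_inv, abs_of_pos hq]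
    calc _ ≤ E * (r^3 * (l^2 - V x))⁻¹ * q⁻¹ := by
          gcongr
          exact abs_deriv_effectivePotential_le hr hQ hb1 hb2 hb3
      _ = E * ((r * q)^3)⁻¹ := by
          rw [← hq2]
          field_simp
      _ ≤ E * (M ^ ((3:ℝ)/2) * (1 + y^2) ^ (-(3:ℝ)/2)) := by
          gcongr
          rw [neg_div, Real.rpow_neg hy0.le, ← div_eq_mul_inv, le_div_iff₀ (by positivity),
            inv_mul_le_iff₀ (by positivity)]
          linarith
      _ ≤ (E * M + E * M ^ ((3:ℝ)/2)) * (1 + y^2) ^ (-(3:ℝ)/2) := by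
          rw [← mul_assoc]
          gcongr
          exact le_add_of_nonneg_left (by positivity)
end
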